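/- Let λ'_{i,j} (i ∈ I₁^ℓ, j ∈ I₁^{ℓ+1}) be the unique coefficients expressing the coarse B-splines of S_{p−1}^{r,ℓ} in terms of the fine ones: N_i^{p−1,r,ℓ} = Σ_j λ'_{i,j} N_j^{p−1,r,ℓ+1}. Then for every i ∈ I₁^ℓ, the difference φ_{Γ₁,i}^ℓ − (1/2) Σ_{j ∈ I₁^{ℓ+1}} λ'_{i,j} φ_{Γ₁,j}^{ℓ+1} belongs to the span of the level-(ℓ+1) patch-interior basis functions {φ_{Ω^(S),i',j'}^{ℓ+1} : S ∈ {L,R}, i' ∈ I^{ℓ+1}∖{0,1}, j' ∈ I^{ℓ+1}}. -/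

import Mathlib

noncomputable section
open Set

namespace TwoPatch



/-- Cox–de Boor recursion for B-splines over the knot sequence `t`.  Degree-`0`
B-splines are the characteristic functions of `[t i, t (i+1))`, closed at the
right endpoint when `t (i+1) = 1` (the right end of the parametric domain),
and the usual convention `0/0 = 0` is used in the recursion. -/
def coxDeBoor (t : ℕ → ℝ) : ℕ → ℕ → ℝ → ℝ
  | 0, i, x =>
      if (t i ≤ x ∧ x < t (i + 1)) ∨ (t i < t (i + 1) ∧ t (i + 1) = 1 ∧ x = 1) then 1 else 0
  | (d + 1), i, x =>
      (if t (i + d + 1) = t i then 0 else (x - t i) / (t (i + d + 1) - t i)) *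
          coxDeBoor t d i x +
        (if t (i + d + 2) = t (i + 1) then 0
          else (t (i + d + 2) - x) / (t (i + d + 2) - t (i + 1))) *
          coxDeBoor t d (i + 1) x

/-- The open knot vector on `[0,1]` of degree `dg`:  `0` and `1` appear with
multiplicity `dg + 1` and each of the `k` inner breakpoints `τ 0 < … < τ (k-1)`
appears with multiplicity `m`. -/
def openKnots (dg m k : ℕ) (τ : ℕ → ℝ) (j : ℕ) : ℝ :=
  if j ≤ dg then 0 else if dg + k * m < j then 1 else τ ((j - (dg + 1)) / m)

/-- The `i`-th B-spline of degree `dg`, inner-knot multiplicity `m`, over the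
breakpoints `τ 0, …, τ (k-1)`. -/
def Bspl (dg m k : ℕ) (τ : ℕ → ℝ) (i : ℕ) : ℝ → ℝ :=
  coxDeBoor (openKnots dg m k τ) dg i

/-- The dimension of the corresponding spline space. -/
def sdim (dg m k : ℕ) : ℕ := dg + 1 + k * m

/-- The univariate spline space, as a subspace of `ℝ → ℝ`. -/
def splineSpace (dg m k : ℕ) (τ : ℕ → ℝ) : Submodule ℝ (ℝ → ℝ) :=
  Submodule.span ℝ (Bspl dg m k τ '' Set.Iio (sdim dg m k))

/-- The tensor-product spline space `span {g(ξ₁)h(ξ₂) : g, h ∈ S}`. -/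
def tensorSpace (dg m k : ℕ) (τ : ℕ → ℝ) : Submodule ℝ (ℝ × ℝ → ℝ) :=
  Submodule.span ℝ
    {f | ∃ g ∈ splineSpace dg m k τ, ∃ h ∈ splineSpace dg m k τ,
        f = fun q : ℝ × ℝ => g q.1 * h q.2}

/-- The parametric interval `[0,1]`. -/
def I01 : Set ℝ := Set.Icc 0 1

/-- The parametric square `[0,1]²`. -/
def sq : Set (ℝ × ℝ) := Set.Icc (0, 0) (1, 1)

/-- Derivative of a univariate function within `[0,1]` (one-sided at the endpoints). -/
def d01 (g : ℝ → ℝ) (x : ℝ) : ℝ := derivWithin g I01 x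

/-- First partial derivative (within `[0,1]` in the first variable). -/
def pd1 (f : ℝ × ℝ → ℝ) (q : ℝ × ℝ) : ℝ := derivWithin (fun s => f (s, q.2)) I01 q.1

/-- Second partial derivative (within `[0,1]` in the second variable). -/
def pd2 (f : ℝ × ℝ → ℝ) (q : ℝ × ℝ) : ℝ := derivWithin (fun s => f (q.1, s)) I01 q.2

/-- First partial derivative of a map into `ℝ²`. -/
def pd1v (F : ℝ × ℝ → ℝ × ℝ) (q : ℝ × ℝ) : ℝ × ℝ :=
  (pd1 (fun x => (F x).1) q, pd1 (fun x => (F x).2) q)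

/-- Second partial derivative of a map into `ℝ²`. -/
def pd2v (F : ℝ × ℝ → ℝ × ℝ) (q : ℝ × ℝ) : ℝ × ℝ :=
  (pd2 (fun x => (F x).1) q, pd2 (fun x => (F x).2) q)

/-- Jacobian determinant. -/
def jacDet (F : ℝ × ℝ → ℝ × ℝ) (q : ℝ × ℝ) : ℝ :=
  pd1 (fun x => (F x).1) q * pd2 (fun x => (F x).2) q -
    pd1 (fun x => (F x).2) q * pd2 (fun x => (F x).1) q

/-- The Jacobian matrix. -/
def jacMat (F : ℝ × ℝ → ℝ × ℝ) (q : ℝ × ℝ) : Matrix (Fin 2) (Fin 2) ℝ :=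
  !![pd1 (fun x => (F x).1) q, pd2 (fun x => (F x).1) q;
     pd1 (fun x => (F x).2) q, pd2 (fun x => (F x).2) q]

/-- Polynomials of degree at most one ("linear functions"). -/
def IsLinearPoly (a : ℝ → ℝ) : Prop := ∃ c₀ c₁ : ℝ, a = fun x => c₀ + c₁ * x

/-- Breakpoints extended by the endpoints `0` and `1`. -/
def extBpt (k : ℕ) (τ : ℕ → ℝ) (i : ℕ) : ℝ :=
  if i = 0 then 0 else if i ≤ k then τ (i - 1) else 1

/-- One dyadic refinement of the breakpoint set `τ 0 < … < τ (k-1)`: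
the old breakpoints together with the midpoints of the `k+1` intervals
determined by `{0} ∪ T ∪ {1}`. -/
def dyadicOnce (k : ℕ) (τ : ℕ → ℝ) (j : ℕ) : ℝ :=
  if j % 2 = 1 then τ (j / 2) else (extBpt k τ (j / 2) + extBpt k τ (j / 2 + 1)) / 2

/-- Number of breakpoints at level `ℓ`. -/
def levelK (k : ℕ) : ℕ → ℕ
  | 0 => k
  | ℓ + 1 => 2 * levelK k ℓ + 1

/-- Breakpoints at level `ℓ` (iterated dyadic refinement). -/
def levelτ (k : ℕ) (τ : ℕ → ℝ) : ℕ → ℕ → ℝ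
  | 0 => τ
  | ℓ + 1 => dyadicOnce (levelK k ℓ) (levelτ k τ ℓ)

/-- Pullback of the interior basis functions: `N_i^{p,r}(ξ₁) N_j^{p,r}(ξ₂)`. -/
def fOmega (p r k : ℕ) (τ : ℕ → ℝ) (i j : ℕ) (q : ℝ × ℝ) : ℝ :=
  Bspl p (p - r) k τ i q.1 * Bspl p (p - r) k τ j q.2

/-- Pullback of the interface basis function `φ_{Γ₀,i}` on the patch with
gluing datum `βS`. -/
def fGamma0 (p r k : ℕ) (τ : ℕ → ℝ) (βS : ℝ → ℝ) (i : ℕ) (q : ℝ × ℝ) : ℝ :=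
  Bspl p (p - r - 1) k τ i q.2 *
      (Bspl p (p - r) k τ 0 q.1 + Bspl p (p - r) k τ 1 q.1) +
    βS q.2 * d01 (Bspl p (p - r - 1) k τ i) q.2 * (τ 0 / (p : ℝ)) * Bspl p (p - r) k τ 1 q.1

/-- Pullback of the interface basis function `φ_{Γ₁,i}` on the patch with
gluing datum `αS`. -/
def fGamma1 (p r k : ℕ) (τ : ℕ → ℝ) (αS : ℝ → ℝ) (i : ℕ) (q : ℝ × ℝ) : ℝ :=
  αS q.2 * Bspl (p - 1) (p - r - 1) k τ i q.2 * Bspl p (p - r) k τ 1 q.1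

/-- Support of a function on the domain `Ω`. -/
def suppOn (Ω : Set (ℝ × ℝ)) (φ : ℝ × ℝ → ℝ) : Set (ℝ × ℝ) :=
  closure {x | x ∈ Ω ∧ φ x ≠ 0}

/-- An analysis-suitable `G¹` two-patch geometry, on the spline space of degree
`p`, regularity `r`, with `k` inner breakpoints `τ 0 < … < τ (k-1)`.  The two
geometry mappings `FL` and `FR` are regular spline parameterizations of the two
patches, and `αL, αR, βL, βR` are the linear gluing data. -/
structure ASG1 where
  p : ℕ
  r : ℕ
  k : ℕ
  τ : ℕ → ℝ
  hp : 3 ≤ p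
  hr : 1 ≤ r
  hrp : r ≤ p - 2
  hτpos : ∀ i < k, 0 < τ i
  hτlt : ∀ i < k, τ i < 1
  hτmono : ∀ i, i + 1 < k → τ i < τ (i + 1)
  /-- left geometry mapping -/
  FL : ℝ × ℝ → ℝ × ℝ
  /-- right geometry mapping -/
  FR : ℝ × ℝ → ℝ × ℝ
  hFL1 : (fun q => (FL q).1) ∈ tensorSpace p (p - r) k τ
  hFL2 : (fun q => (FL q).2) ∈ tensorSpace p (p - r) k τ
  hFR1 : (fun q => (FR q).1) ∈ tensorSpace p (p - r) k τ
  hFR2 : (fun q => (FR q).2) ∈ tensorSpace p (p - r) k τ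
  hFLc1 : ContDiffOn ℝ 1 FL sq
  hFRc1 : ContDiffOn ℝ 1 FR sq
  hFLinj : Set.InjOn FL sq
  hFRinj : Set.InjOn FR sq
  hFLjac : ∀ q ∈ sq, jacDet FL q ≠ 0
  hFRjac : ∀ q ∈ sq, jacDet FR q ≠ 0
  /-- the two patches share the interface `ξ₁ = 0` -/
  hIface : ∀ ξ ∈ I01, FL (0, ξ) = FR (0, ξ)
  /-- the patches intersect exactly in the common interface -/
  hGamma : FL '' sq ∩ FR '' sq = (fun ξ : ℝ => FL (0, ξ)) '' I01
  /-- gluing data -/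
  αL : ℝ → ℝ
  αR : ℝ → ℝ
  βL : ℝ → ℝ
  βR : ℝ → ℝ
  hαLlin : IsLinearPoly αL
  hαRlin : IsLinearPoly αR
  hβLlin : IsLinearPoly βL
  hβRlin : IsLinearPoly βR
  hαneg : ∀ ξ ∈ I01, αL ξ * αR ξ < 0
  /-- the analysis-suitable `G¹` condition -/
  hG1 : ∀ ξ ∈ I01,
      αR ξ • pd1v FL (0, ξ) - αL ξ • pd1v FR (0, ξ) +
          (αL ξ * βR ξ - αR ξ * βL ξ) • pd2v FL (0, ξ) = 0

/-- The function `β = α^(L) β^(R) − α^(R) β^(L)`. -/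
def ASG1.beta (G : ASG1) : ℝ → ℝ := fun ξ => G.αL ξ * G.βR ξ - G.αR ξ * G.βL ξ

/-- The left patch `Ω^(L)`. -/
def ASG1.ΩL (G : ASG1) : Set (ℝ × ℝ) := G.FL '' sq

/-- The right patch `Ω^(R)`. -/
def ASG1.ΩR (G : ASG1) : Set (ℝ × ℝ) := G.FR '' sq

/-- The two-patch domain `Ω = Ω^(L) ∪ Ω^(R)`. -/
def ASG1.dom (G : ASG1) : Set (ℝ × ℝ) := G.ΩL ∪ G.ΩR

/-- The interface `Γ`. -/
def ASG1.iface (G : ASG1) : Set (ℝ × ℝ) := (fun ξ : ℝ => G.FL (0, ξ)) '' I01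

-- The function on `Ω` whose pullbacks to the two patches are `fL` and `fR`
-- (extended by `0` outside `Ω`).
open Classical in
def ASG1.glue (G : ASG1) (fL fR : ℝ × ℝ → ℝ) (x : ℝ × ℝ) : ℝ :=
  if x ∈ G.ΩL then fL (Function.invFunOn G.FL sq x)
  else if x ∈ G.ΩR then fR (Function.invFunOn G.FR sq x)
  else 0

/-- Indices for the basis `Φ` of the `C¹` space `W`. -/
inductive PhiIdx where
  | inL (i j : ℕ) : PhiIdx
  | inR (i j : ℕ) : PhiIdx
  | g0 (i : ℕ) : PhiIdx
  | g1 (i : ℕ) : PhiIdx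

/-- The valid index ranges for the basis `Φ` (for degree `p`, regularity `r`,
`k` inner breakpoints). -/
def PhiIdx.valid (p r k : ℕ) : PhiIdx → Prop
  | .inL i j => 2 ≤ i ∧ i < sdim p (p - r) k ∧ j < sdim p (p - r) k
  | .inR i j => 2 ≤ i ∧ i < sdim p (p - r) k ∧ j < sdim p (p - r) k
  | .g0 i => i < sdim p (p - r - 1) k
  | .g1 i => i < sdim (p - 1) (p - r - 1) k

/-- The basis functions of the `C¹` space `W`, for breakpoints `τ' 0 < … < τ' (k'-1)`. -/
def ASG1.phiAt (G : ASG1) (k' : ℕ) (τ' : ℕ → ℝ) : PhiIdx → ℝ × ℝ → ℝ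
  | .inL i j => G.glue (fOmega G.p G.r k' τ' i j) (fun _ => 0)
  | .inR i j => G.glue (fun _ => 0) (fOmega G.p G.r k' τ' i j)
  | .g0 i => G.glue (fGamma0 G.p G.r k' τ' G.βL i) (fGamma0 G.p G.r k' τ' G.βR i)
  | .g1 i => G.glue (fGamma1 G.p G.r k' τ' G.αL i) (fGamma1 G.p G.r k' τ' G.αR i)

/-- The level-`ℓ` basis functions. -/
def ASG1.phiLvl (G : ASG1) (ℓ : ℕ) : PhiIdx → ℝ × ℝ → ℝ :=
  G.phiAt (levelK G.k ℓ) (levelτ G.k G.τ ℓ)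

/-- The level-`ℓ` basis `Φ^ℓ`, as a set of functions on the two-patch domain. -/
def ASG1.PhiSetLvl (G : ASG1) (ℓ : ℕ) : Set (ℝ × ℝ → ℝ) :=
  G.phiLvl ℓ '' {e | e.valid G.p G.r (levelK G.k ℓ)}

/-- The basis `Φ` (level `0`). -/
def ASG1.PhiSet (G : ASG1) : Set (ℝ × ℝ → ℝ) := G.PhiSetLvl 0

/-! ### B-splines over a monotone knot sequence -/

lemma coxDeBoor_eq_zero_of_lt {t : ℕ → ℝ} (ht : Monotone t) {x : ℝ} :
    ∀ (d i : ℕ), x < t i → coxDeBoor t d i x = 0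
  | 0, i, h => by
      have h1 := ht (Nat.le_succ i)
      simp only [coxDeBoor]
      rw [if_neg]
      rintro (⟨h2, _⟩ | ⟨h2, h3, h4⟩) <;> simp only [Nat.succ_eq_add_one] at h1 <;> linarith
  | d + 1, i, h => by
      have h1 := ht (Nat.le_succ i)
      simp only [coxDeBoor]
      rw [coxDeBoor_eq_zero_of_lt ht d i h,
        coxDeBoor_eq_zero_of_lt ht d (i + 1) (lt_of_lt_of_le h h1)]
      simp

lemma coxDeBoor_eq_zero_of_ge {t : ℕ → ℝ} (ht : Monotone t) {x : ℝ} :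
    ∀ (d i : ℕ), t (i + d + 1) ≤ x → (t (i + d + 1) = 1 → x ≠ 1) → coxDeBoor t d i x = 0
  | 0, i, h, h' => by
      simp only [coxDeBoor]
      rw [if_neg]
      rintro (⟨_, h2⟩ | ⟨_, h3, h4⟩)
      · exact absurd h (not_le.2 h2)
      · exact h' h3 h4
  | d + 1, i, h, h' => by
      have h1 : t (i + d + 1) ≤ t (i + (d + 1) + 1) := ht (by omega)
      have e : i + 1 + d + 1 = i + (d + 1) + 1 := by omega
      simp only [coxDeBoor]
      rw [coxDeBoor_eq_zero_of_ge ht d i (h1.trans h) ?_,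
        coxDeBoor_eq_zero_of_ge ht d (i + 1) (by rwa [e]) (by rwa [e])]
      · simp
      · intro h2 h3
        exact h' (by linarith) h3

lemma coxDeBoor_eq_zero_of_eq {t : ℕ → ℝ} (ht : Monotone t) (x : ℝ) :
    ∀ (d i : ℕ), t (i + d + 1) = t i → coxDeBoor t d i x = 0
  | 0, i, h => by
      simp only [coxDeBoor]
      rw [if_neg]
      simp only [add_zero] at h
      rintro (⟨h1, h2⟩ | ⟨h1, _⟩) <;> linarith
  | d + 1, i, h => by
      have h1 : t (i + d + 1) ≤ t (i + (d + 1) + 1) := ht (by omega)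
      have h2 : t i ≤ t (i + 1) := ht (by omega)
      have h3 : t (i + 1) ≤ t (i + d + 1) := ht (by omega)
      have e : i + 1 + d + 1 = i + (d + 1) + 1 := by omega
      simp only [coxDeBoor]
      rw [coxDeBoor_eq_zero_of_eq ht x d i (by linarith),
        coxDeBoor_eq_zero_of_eq ht x d (i + 1) (by rw [e]; linarith)]
      simp

/-- An open knot sequence on `[0,1]` of degree `D` with `n` associated B-splines. -/
structure IsOpenKnot (t : ℕ → ℝ) (D n : ℕ) : Prop where
  mono : Monotone t
  zero : ∀ i ≤ D, t i = 0
  one : ∀ i, n ≤ i → t i = 1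

lemma IsOpenKnot.nonneg {t : ℕ → ℝ} {D n : ℕ} (ht : IsOpenKnot t D n) (i : ℕ) : 0 ≤ t i := by
  rw [← ht.zero 0 (Nat.zero_le _)]
  exact ht.mono (Nat.zero_le _)

lemma IsOpenKnot.le_one {t : ℕ → ℝ} {D n : ℕ} (ht : IsOpenKnot t D n) (i : ℕ) : t i ≤ 1 := by
  rw [← ht.one (max i n) (le_max_right _ _)]
  exact ht.mono (le_max_left _ _)

lemma IsOpenKnot.coxDeBoor_eq_zero {t : ℕ → ℝ} {D n : ℕ} (ht : IsOpenKnot t D n) (d i : ℕ)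
    {x : ℝ} (hx : x ∉ I01) : coxDeBoor t d i x = 0 := by
  by_cases h : x < t i
  · exact coxDeBoor_eq_zero_of_lt ht.mono d i h
  · have h1 := ht.nonneg i
    have h2 := ht.le_one (i + d + 1)
    have h3 : 1 < x := by
      by_contra h3
      exact hx ⟨by linarith, by linarith⟩
    exact coxDeBoor_eq_zero_of_ge ht.mono d i (by linarith) (fun _ => by linarith)

lemma IsOpenKnot.sum_coxDeBoor_zero {t : ℕ → ℝ} {D n : ℕ} (ht : IsOpenKnot t D n)
    {x : ℝ} (hx : x ∈ I01) : ∑ i ∈ Finset.range n, coxDeBoor t 0 i x = 1 := by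
  have hx0 : 0 ≤ x := hx.1
  rcases lt_or_eq_of_le hx.2 with h | h
  · have key : ∀ i, coxDeBoor t 0 i x =
        (if t i ≤ x then (1 : ℝ) else 0) - (if t (i + 1) ≤ x then 1 else 0) := by
      intro i
      have := ht.mono (Nat.le_succ i)
      simp only [Nat.succ_eq_add_one] at this
      simp only [coxDeBoor, h.ne, and_false, or_false]
      split_ifs <;> first | (exfalso; grind) | simp
    simp_rw [key]
    rw [Finset.sum_range_sub' (fun i => if t i ≤ x then (1 : ℝ) else 0), ht.zero 0 (Nat.zero_le _),
      ht.one n le_rfl]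
    simp [hx0, h]
  · have key : ∀ i, coxDeBoor t 0 i x =
        (if t i < 1 then (1 : ℝ) else 0) - (if t (i + 1) < 1 then 1 else 0) := by
      intro i
      have h1 := ht.mono (Nat.le_succ i)
      have h2 := ht.le_one (i + 1)
      simp only [Nat.succ_eq_add_one] at h1
      simp only [coxDeBoor, h]
      split_ifs <;> first | (exfalso; grind) | simp
    simp_rw [key]
    rw [Finset.sum_range_sub' (fun i => if t i < 1 then (1 : ℝ) else 0), ht.zero 0 (Nat.zero_le _),
      ht.one n le_rfl]
    simp

open Polynomial in
/-- The dual polynomial `∏_{j=1}^{d} (X - t_{i+j})` of Marsden's identity. -/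
def dualPoly (t : ℕ → ℝ) (d i : ℕ) : ℝ[X] :=
  ∏ j ∈ Finset.Ico (i + 1) (i + 1 + d), (X - C (t j))

open Polynomial in
/-- Marsden's identity. -/
lemma IsOpenKnot.marsden {t : ℕ → ℝ} {D n : ℕ} (ht : IsOpenKnot t D n)
    {x : ℝ} (hx : x ∈ I01) (d : ℕ) (hd : d ≤ D) :
    ∑ i ∈ Finset.range n, C (coxDeBoor t d i x) * dualPoly t d i = (X - C x) ^ d := by
  induction d with
  | zero =>
    simp only [dualPoly, add_zero, Finset.Ico_self, Finset.prod_empty, mul_one, pow_zero]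
    rw [← map_sum, ht.sum_coxDeBoor_zero hx, map_one]
  | succ d ih =>
    have ih := ih (by omega)
    set w : ℕ → ℝ := fun i => (x - t i) / (t (i + d + 1) - t i) with hw
    set f : ℕ → ℝ[X] := fun i =>
      C ((1 - w i) * coxDeBoor t d i x) *
        ∏ j ∈ Finset.Ico i (i + (d + 1)), (X - C (t j)) with hf
    have h0 : coxDeBoor t d 0 x = 0 := by
      apply coxDeBoor_eq_zero_of_eq ht.mono
      rw [ht.zero _ (by omega), ht.zero _ (by omega)]
    have hn : coxDeBoor t d n x = 0 := by
      apply coxDeBoor_eq_zero_of_eq ht.mono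
      rw [ht.one _ (by omega), ht.one _ (by omega)]
    have hrec : ∀ i, coxDeBoor t (d + 1) i x =
        w i * coxDeBoor t d i x + (1 - w (i + 1)) * coxDeBoor t d (i + 1) x := by
      intro i
      simp only [coxDeBoor, hw]
      congr 1
      · split_ifs with h
        · rw [coxDeBoor_eq_zero_of_eq ht.mono x d i h]; simp
        · rfl
      · have e : i + 1 + d + 1 = i + d + 2 := by omega
        rw [e]
        split_ifs with h
        · rw [coxDeBoor_eq_zero_of_eq ht.mono x d (i + 1) (by rw [e]; exact h)]; simp
        · have : t (i + d + 2) - t (i + 1) ≠ 0 := sub_ne_zero.2 h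
          congr 1
          field_simp
          ring
    have hstep : ∀ i, C (coxDeBoor t (d + 1) i x) * dualPoly t (d + 1) i =
        (X - C x) * (C (coxDeBoor t d i x) * dualPoly t d i) + (f (i + 1) - f i) := by
      intro i
      have e1 : ∏ j ∈ Finset.Ico i (i + (d + 1)), (X - C (t j)) =
          (X - C (t i)) * dualPoly t d i := by
        rw [dualPoly, Finset.prod_eq_prod_Ico_succ_bot (by omega)]
        congr 2
        congr 1
        omega
      have e2 : dualPoly t (d + 1) i = (X - C (t (i + d + 1))) * dualPoly t d i := by
        rw [dualPoly, dualPoly, ← add_assoc, Finset.prod_Ico_succ_top (by omega), mul_comm]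
        congr 4
        omega
      have e3 : ∏ j ∈ Finset.Ico (i + 1) (i + 1 + (d + 1)), (X - C (t j)) =
          dualPoly t (d + 1) i := rfl
      have e4 : C (coxDeBoor t d i x) * ((X - C (t (i + d + 1))) * C (w i) +
          (X - C (t i)) * (1 - C (w i))) = C (coxDeBoor t d i x) * (X - C x) := by
        by_cases h : t (i + d + 1) = t i
        · rw [coxDeBoor_eq_zero_of_eq ht.mono x d i h]; simp
        · congr 1
          have h' : t (i + d + 1) - t i ≠ 0 := sub_ne_zero.2 h
          have : x = t i + w i * (t (i + d + 1) - t i) := by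
            simp only [hw]
            field_simp
            ring
          rw [this]
          simp only [map_add, map_mul, map_sub]
          ring
      simp only [hf, e1, e3, hrec i, map_add, map_mul, map_sub, map_one]
      rw [e2]
      linear_combination (dualPoly t d i) * e4
    rw [Finset.sum_congr rfl fun i _ => hstep i, Finset.sum_add_distrib, ← Finset.mul_sum, ih,
      Finset.sum_range_sub, pow_succ']
    simp [hf, h0, hn]

/-! ### Truncated powers -/

/-- The monomial `x ^ j`, restricted to `[0,1]`. -/
def monoI (j : ℕ) (x : ℝ) : ℝ := open Classical in if x ∈ I01 then x ^ j else 0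

/-- The truncated power `(c - x)_+ ^ e`, restricted to `[0,1]`. -/
def truncI (c : ℝ) (e : ℕ) (x : ℝ) : ℝ :=
  open Classical in if x ∈ I01 ∧ x < c then (c - x) ^ e else 0

/-- Monomials and truncated powers spanning the piecewise polynomials of degree `d` whose
smoothness at the breakpoints is `d - m`. -/
def ppFam (d m k : ℕ) (τ : ℕ → ℝ) : Fin (d + 1) ⊕ Fin k × Fin m → ℝ → ℝ :=
  Sum.elim (fun j => monoI j) (fun a => truncI (τ a.1) (d - a.2))

open Polynomial in
lemma IsOpenKnot.sum_taylor {t : ℕ → ℝ} {D n : ℕ} (ht : IsOpenKnot t D n)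
    {x : ℝ} (hx : x ∈ I01) (c : ℝ) (s : ℕ) :
    ∑ i ∈ Finset.range n, (taylor c (dualPoly t D i)).coeff s * coxDeBoor t D i x =
      (c - x) ^ (D - s) * D.choose s := by
  have h := congrArg (fun q => (taylor c q).coeff s) (ht.marsden hx D le_rfl)
  simp only [map_sum, finsetSum_coeff, taylor_mul, taylor_C, coeff_C_mul, taylor_pow, map_sub,
    taylor_X] at h
  have e : (X + C c - C x : ℝ[X]) = X + C (c - x) := by rw [map_sub]; ring
  rw [e, coeff_X_add_C_pow] at h
  rw [← h]
  exact Finset.sum_congr rfl fun i _ => mul_comm _ _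

lemma IsOpenKnot.monoI_mem {t : ℕ → ℝ} {D n : ℕ} (ht : IsOpenKnot t D n) {j : ℕ} (hj : j ≤ D) :
    monoI j ∈ Submodule.span ℝ (coxDeBoor t D '' Set.Iio n) := by
  have h : monoI j = ∑ i ∈ Finset.range n, ((-1) ^ j * ((D.choose (D - j) : ℝ))⁻¹ *
      (Polynomial.taylor 0 (dualPoly t D i)).coeff (D - j)) • coxDeBoor t D i := by
    ext x
    simp only [Finset.sum_apply, Pi.smul_apply, smul_eq_mul, monoI]
    split_ifs with hx
    · have h1 := ht.sum_taylor hx 0 (D - j)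
      have h2 : (D.choose (D - j) : ℝ) ≠ 0 := by
        exact_mod_cast (Nat.choose_pos (Nat.sub_le _ _)).ne'
      simp only [mul_assoc]
      rw [← Finset.mul_sum, ← Finset.mul_sum, h1, show D - (D - j) = j by omega, zero_sub, neg_pow]
      have h3 : ((-1 : ℝ) ^ j) * (-1) ^ j = 1 := by
        rw [← mul_pow]; simp
      field_simp
      linear_combination (- x ^ j) * h3
    · simp [ht.coxDeBoor_eq_zero D _ hx]
  rw [h]
  refine Submodule.sum_mem _ fun i hi => Submodule.smul_mem _ _ (Submodule.subset_span ⟨i, ?_, rfl⟩)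
  simpa using hi

open Polynomial in
lemma IsOpenKnot.truncI_mem {t : ℕ → ℝ} {D n : ℕ} (ht : IsOpenKnot t D n) {c : ℝ} {a m s : ℕ}
    (hc : c < 1) (ha : ∀ j, a ≤ j → j < a + m → t j = c) (hs : s < m) (hD : s ≤ D) :
    truncI c (D - s) ∈ Submodule.span ℝ (coxDeBoor t D '' Set.Iio n) := by
  classical
  have h : truncI c (D - s) = ∑ i ∈ Finset.range n, (((D.choose s : ℝ))⁻¹ *
      (if t (i + D + 1) ≤ c then (taylor c (dualPoly t D i)).coeff s else 0)) •
        coxDeBoor t D i := by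
    ext x
    simp only [Finset.sum_apply, Pi.smul_apply, smul_eq_mul, truncI]
    split_ifs with hx
    · have h1 := ht.sum_taylor hx.1 c s
      have h2 : (D.choose s : ℝ) ≠ 0 := by exact_mod_cast (Nat.choose_pos hD).ne'
      have h3 : ∀ i, (if t (i + D + 1) ≤ c then (taylor c (dualPoly t D i)).coeff s else 0) *
          coxDeBoor t D i x = (taylor c (dualPoly t D i)).coeff s * coxDeBoor t D i x := by
        intro i
        split_ifs with hi
        · rfl
        · push Not at hi
          by_cases hti : t i < c
          · have hia : i < a := by
              by_contra hia
              have := ht.mono (not_lt.1 hia)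
              rw [ha a le_rfl (by omega)] at this
              linarith
            have hib : a + m - 1 < i + D + 1 := by
              by_contra hib
              have := ht.mono (not_lt.1 hib)
              rw [ha (a + m - 1) (by omega) (by omega)] at this
              linarith
            have hdvd : (X - C c) ^ m ∣ dualPoly t D i := by
              have e : ∏ j ∈ Finset.Ico a (a + m), (X - C (t j)) = (X - C c) ^ m := by
                rw [Finset.prod_congr rfl (g := fun _ => X - C c), Finset.prod_const]
                · simp
                · intro j hj
                  rw [Finset.mem_Ico] at hj
                  rw [ha j hj.1 hj.2]
              rw [← e]
              refine Finset.prod_dvd_prod_of_subset _ _ _ (Finset.Ico_subset_Ico ?_ ?_) <;> omega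
            obtain ⟨q, hq⟩ := hdvd
            have : (taylor c (dualPoly t D i)).coeff s = 0 := by
              refine (X_pow_dvd_iff (n := m)).1 ⟨taylor c q, ?_⟩ s hs
              rw [hq, taylor_mul, taylor_pow, map_sub, taylor_X, taylor_C, add_sub_cancel_right]
            rw [this]
          · rw [coxDeBoor_eq_zero_of_lt ht.mono D i (lt_of_lt_of_le hx.2 (not_lt.1 hti))]
            simp
      simp only [mul_assoc]
      rw [← Finset.mul_sum, Finset.sum_congr rfl fun i _ => h3 i, h1]
      field_simp
    · symm
      refine Finset.sum_eq_zero fun i _ => ?_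
      by_cases hxI : x ∈ I01
      · have hxc : c ≤ x := not_lt.1 fun h => hx ⟨hxI, h⟩
        split_ifs with hi
        · rw [coxDeBoor_eq_zero_of_ge ht.mono D i (hi.trans hxc) (fun h => by linarith)]
          simp
        · simp
      · simp [ht.coxDeBoor_eq_zero D _ hxI]
  rw [h]
  refine Submodule.sum_mem _ fun i hi => Submodule.smul_mem _ _ (Submodule.subset_span ⟨i, ?_, rfl⟩)
  simpa using hi

open Polynomial in
lemma ppFam_linearIndependent_aux {d m : ℕ} (hm : m ≤ d) (c : ℝ) (b : Fin m → ℝ)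
    (h : ∑ s : Fin m, C (b s) * (C c - X : ℝ[X]) ^ (d - (s : ℕ)) = 0) (s : Fin m) : b s = 0 := by
  have h1 := congrArg (fun q => (q.comp (C c - X)).coeff (d - (s : ℕ))) h
  simp only [← coe_compRingHom_apply, map_sum, map_mul, map_pow, map_sub] at h1
  simp only [coe_compRingHom_apply, C_comp, X_comp, sub_sub_cancel, finsetSum_coeff,
    coeff_C_mul, coeff_X_pow, zero_comp, coeff_zero] at h1
  rw [Finset.sum_eq_single s] at h1
  · simpa using h1
  · intro s' _ hs'
    rw [if_neg, mul_zero]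
    intro h2
    apply hs'
    ext
    omega
  · simp

/-- The breakpoints together with `0` and `1` are strictly increasing. -/
def GoodBpt (k : ℕ) (τ : ℕ → ℝ) : Prop := ∀ i ≤ k, extBpt k τ i < extBpt k τ (i + 1)

lemma extBpt_zero (k : ℕ) (τ : ℕ → ℝ) : extBpt k τ 0 = 0 := by simp [extBpt]

lemma extBpt_succ {k i : ℕ} (τ : ℕ → ℝ) (hi : i < k) : extBpt k τ (i + 1) = τ i := by
  simp [extBpt, Nat.succ_le_of_lt hi]

lemma extBpt_of_gt {k i : ℕ} (τ : ℕ → ℝ) (hi : k < i) : extBpt k τ i = 1 := by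
  simp [extBpt, show i ≠ 0 by omega, not_le.2 hi]

lemma GoodBpt.monotone {k : ℕ} {τ : ℕ → ℝ} (h : GoodBpt k τ) : Monotone (extBpt k τ) := by
  refine monotone_nat_of_le_succ fun i => ?_
  by_cases hi : i ≤ k
  · exact (h i hi).le
  · rw [extBpt_of_gt τ (by omega), extBpt_of_gt τ (by omega)]

lemma GoodBpt.nonneg {k : ℕ} {τ : ℕ → ℝ} (h : GoodBpt k τ) (i : ℕ) : 0 ≤ extBpt k τ i := by
  rw [← extBpt_zero k τ]
  exact h.monotone (Nat.zero_le _)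

lemma GoodBpt.le_one {k : ℕ} {τ : ℕ → ℝ} (h : GoodBpt k τ) (i : ℕ) : extBpt k τ i ≤ 1 := by
  rw [← extBpt_of_gt τ (show k < max i (k + 1) by omega)]
  exact h.monotone (le_max_left _ _)

lemma GoodBpt.lt_one {k : ℕ} {τ : ℕ → ℝ} (h : GoodBpt k τ) {i : ℕ} (hi : i < k) : τ i < 1 := by
  rw [← extBpt_succ τ hi]
  exact (h (i + 1) (by omega)).trans_le (h.le_one _)

lemma GoodBpt.isOpenKnot {k : ℕ} {τ : ℕ → ℝ} (h : GoodBpt k τ) (d m : ℕ) :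
    IsOpenKnot (openKnots d m k τ) d (sdim d m k) := by
  have key : ∀ j, openKnots d m k τ j = extBpt k τ
      (if j ≤ d then 0 else if d + k * m < j then k + 1 else (j - (d + 1)) / m + 1) := by
    intro j
    simp only [openKnots]
    split_ifs with h1 h2
    · rw [extBpt_zero]
    · rw [extBpt_of_gt τ (by omega)]
    · rw [extBpt_succ]
      rw [Nat.div_lt_iff_lt_mul]
      · omega
      · rcases Nat.eq_zero_or_pos m with rfl | hm
        · simp only [mul_zero] at h2; omega
        · exact hm
  refine ⟨fun i j hij => ?_, fun i hi => by simp [openKnots, hi], fun i hi => ?_⟩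
  · rw [key, key]
    apply h.monotone
    have h3 : (i - (d + 1)) / m ≤ (j - (d + 1)) / m := Nat.div_le_div_right (by omega)
    have h4 : ¬ (d + k * m < i) → ¬ i ≤ d → (i - (d + 1)) / m < k := by
      intro h1 h2
      rw [Nat.div_lt_iff_lt_mul]
      · omega
      · rcases Nat.eq_zero_or_pos m with rfl | hm
        · simp only [mul_zero] at h1; omega
        · exact hm
    generalize (i - (d + 1)) / m = qi at *
    generalize (j - (d + 1)) / m = qj at *
    split_ifs <;> omega
  · simp only [sdim] at hi
    simp only [openKnots]
    rw [if_neg (by omega), if_pos (by omega)]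

lemma openKnots_block {d m k : ℕ} (τ : ℕ → ℝ) {i j : ℕ} (hi : i < k)
    (h1 : d + 1 + i * m ≤ j) (h2 : j < d + 1 + i * m + m) : openKnots d m k τ j = τ i := by
  have h3 : (i + 1) * m ≤ k * m := Nat.mul_le_mul_right _ hi
  have h4 : (i + 1) * m = i * m + m := by ring
  simp only [openKnots]
  rw [if_neg (by omega), if_neg (by omega)]
  congr 1
  rw [Nat.div_eq_iff (by omega)]
  constructor <;> omega

lemma openKnots_first {d m k : ℕ} (τ : ℕ → ℝ) (hm : 1 ≤ m) :
    openKnots d m k τ (d + 1) = extBpt k τ 1 := by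
  rcases Nat.eq_zero_or_pos k with rfl | hk
  · simp [openKnots, extBpt]
  · rw [openKnots_block τ hk (by omega) (by omega), extBpt_succ τ hk]

/-- The span of `ppFam`. -/
def ppSpace (d m k : ℕ) (τ : ℕ → ℝ) : Submodule ℝ (ℝ → ℝ) :=
  Submodule.span ℝ (Set.range (ppFam d m k τ))

lemma GoodBpt.ppSpace_le {k : ℕ} {τ : ℕ → ℝ} (h : GoodBpt k τ) {d m : ℕ} (hm : m ≤ d) :
    ppSpace d m k τ ≤ splineSpace d m k τ := by
  have hk := h.isOpenKnot d m
  rw [ppSpace, Submodule.span_le]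
  rintro _ ⟨j | ⟨i, s⟩, rfl⟩
  · exact hk.monoI_mem (by omega)
  · exact hk.truncI_mem (a := d + 1 + i * m) (m := m) (h.lt_one i.2)
      (fun j h1 h2 => openKnots_block τ i.2 h1 h2) s.2 (by omega)

open Polynomial in
lemma GoodBpt.ppFam_linearIndependent {k : ℕ} {τ : ℕ → ℝ} (h : GoodBpt k τ) {d m : ℕ}
    (hm : m ≤ d) : LinearIndependent ℝ (ppFam d m k τ) := by
  classical
  rw [Fintype.linearIndependent_iff]
  intro g hg
  set P : ℝ[X] := ∑ j : Fin (d + 1), C (g (Sum.inl j)) * X ^ (j : ℕ) with hP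
  set Q : Fin k → ℝ[X] := fun i =>
    ∑ s : Fin m, C (g (Sum.inr (i, s))) * (C (τ i) - X) ^ (d - (s : ℕ)) with hQ
  set R : ℕ → ℝ[X] := fun l => P + ∑ i : Fin k, if l ≤ (i : ℕ) then Q i else 0 with hR
  have hR0 : ∀ l ≤ k, R l = 0 := by
    intro l hl
    refine Polynomial.eq_zero_of_infinite_isRoot _
      (Set.Infinite.mono ?_ (Set.Ico_infinite (h l hl)))
    intro x hx
    have hxI : x ∈ I01 := ⟨(h.nonneg l).trans hx.1, hx.2.le.trans (h.le_one _)⟩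
    have hiff : ∀ i : Fin k, x < τ i ↔ l ≤ (i : ℕ) := by
      intro i
      rw [← extBpt_succ τ i.2]
      constructor
      · intro h1
        by_contra h2
        have := h.monotone (show (i : ℕ) + 1 ≤ l by omega)
        linarith [hx.1]
      · intro h1
        exact hx.2.trans_le (h.monotone (by omega))
    have h1 := congrFun hg x
    simp only [Fintype.sum_sum_type, Fintype.sum_prod_type, Finset.sum_apply,
      Pi.smul_apply, smul_eq_mul, ppFam, Sum.elim_inl, Sum.elim_inr, monoI, truncI, hxI,
      true_and, if_true, hiff, Pi.zero_apply] at h1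
    simp only [Set.mem_ofPred_eq, IsRoot.def, hR, eval_add, eval_finsetSum, hP]
    rw [← h1]
    congr 1
    · simp
    · refine Finset.sum_congr rfl fun i _ => ?_
      split_ifs
      · simp [hQ, eval_finsetSum]
      · simp
  have hP0 : P = 0 := by
    rw [← hR0 k le_rfl]
    simp only [hR]
    rw [Finset.sum_eq_zero, add_zero]
    intro i _
    rw [if_neg (by omega)]
  have hQ0 : ∀ i, Q i = 0 := by
    intro i
    have h1 : R i - R (i + 1) = Q i := by
      simp only [hR]
      rw [add_sub_add_left_eq_sub, ← Finset.sum_sub_distrib, Finset.sum_eq_single i]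
      · simp
      · intro j _ hj
        have : (j : ℕ) ≠ i := fun h => hj (Fin.ext h)
        by_cases h2 : (i : ℕ) ≤ j
        · rw [if_pos h2, if_pos (by omega), sub_self]
        · rw [if_neg h2, if_neg (by omega), sub_self]
      · simp
    rw [← h1, hR0 _ (by omega), hR0 _ (by omega), sub_self]
  rintro (j | ⟨i, s⟩)
  · have h1 := congrArg (fun q => q.coeff (j : ℕ)) hP0
    simp only [hP, finsetSum_coeff, coeff_C_mul, coeff_X_pow, coeff_zero] at h1
    rw [Finset.sum_eq_single j] at h1
    · simpa using h1
    · intro j' _ hj'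
      rw [if_neg fun h => hj' (Fin.ext h.symm), mul_zero]
    · simp
  · exact ppFam_linearIndependent_aux hm (τ i) (fun s => g (Sum.inr (i, s))) (hQ0 i) s

/-- B-splines and truncated powers span the same space (Curry–Schoenberg). -/
lemma GoodBpt.ppSpace_eq {k : ℕ} {τ : ℕ → ℝ} (h : GoodBpt k τ) {d m : ℕ} (hm : m ≤ d) :
    ppSpace d m k τ = splineSpace d m k τ := by
  have e : splineSpace d m k τ =
      Submodule.span ℝ (Set.range fun i : Fin (sdim d m k) => Bspl d m k τ i) := by
    rw [splineSpace]
    congr 1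
    ext f
    constructor
    · rintro ⟨i, hi, rfl⟩
      exact ⟨⟨i, hi⟩, rfl⟩
    · rintro ⟨i, rfl⟩
      exact ⟨i, i.2, rfl⟩
  have : FiniteDimensional ℝ (splineSpace d m k τ) := by
    rw [e]
    exact FiniteDimensional.span_of_finite ℝ (Set.finite_range _)
  refine Submodule.eq_of_le_of_finrank_le (h.ppSpace_le hm) ?_
  rw [ppSpace, finrank_span_eq_card (h.ppFam_linearIndependent hm), e]
  refine (finrank_range_le_card _).trans ?_
  rw [Fintype.card_fin]
  simp [sdim]

/-! ### Dyadic refinement -/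

lemma extBpt_dyadicOnce_even {k : ℕ} (τ : ℕ → ℝ) (i : ℕ) :
    extBpt (2 * k + 1) (dyadicOnce k τ) (2 * i) = extBpt k τ i := by
  rcases Nat.eq_zero_or_pos i with rfl | hi
  · simp [extBpt]
  · by_cases h : i ≤ k
    · obtain ⟨i, rfl⟩ := Nat.exists_eq_add_of_lt hi
      rw [show 2 * (0 + i + 1) = (2 * i + 1) + 1 by ring, extBpt_succ _ (by omega),
        extBpt_succ _ (by omega), dyadicOnce, if_pos (by omega)]
      congr 1
      omega
    · rw [extBpt_of_gt _ (by omega), extBpt_of_gt _ (by omega)]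

lemma extBpt_dyadicOnce_odd {k : ℕ} (τ : ℕ → ℝ) {i : ℕ} (hi : i ≤ k) :
    extBpt (2 * k + 1) (dyadicOnce k τ) (2 * i + 1) =
      (extBpt k τ i + extBpt k τ (i + 1)) / 2 := by
  rw [extBpt_succ _ (by omega), dyadicOnce, if_neg (by omega)]
  have : 2 * i / 2 = i := by omega
  rw [this]

lemma GoodBpt.refine {k : ℕ} {τ : ℕ → ℝ} (h : GoodBpt k τ) :
    GoodBpt (2 * k + 1) (dyadicOnce k τ) := by
  intro i hi
  rcases Nat.even_or_odd' i with ⟨j, rfl | rfl⟩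
  · have := h j (by omega)
    rw [extBpt_dyadicOnce_even, extBpt_dyadicOnce_odd τ (by omega)]
    linarith
  · have := h j (by omega)
    rw [extBpt_dyadicOnce_odd τ (by omega), show 2 * j + 1 + 1 = 2 * (j + 1) by ring,
      extBpt_dyadicOnce_even]
    linarith

lemma ASG1.goodBpt (G : ASG1) : ∀ ℓ, GoodBpt (levelK G.k ℓ) (levelτ G.k G.τ ℓ)
  | 0 => by
      intro i hi
      simp only [levelK] at hi
      simp only [levelK, levelτ]
      rcases Nat.eq_zero_or_pos i with rfl | hi0
      · rw [extBpt_zero]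
        by_cases h : 0 < G.k
        · rw [extBpt_succ _ h]; exact G.hτpos 0 h
        · rw [extBpt_of_gt _ (by omega)]; exact one_pos
      · obtain ⟨i, rfl⟩ := Nat.exists_eq_add_of_lt hi0
        rw [zero_add] at *
        rw [extBpt_succ _ (by omega)]
        by_cases h : i + 1 < G.k
        · rw [extBpt_succ _ h]; exact G.hτmono i h
        · rw [extBpt_of_gt _ (by omega)]; exact G.hτlt i (by omega)
  | ℓ + 1 => (G.goodBpt ℓ).refine

lemma ppSpace_le_dyadicOnce (d m k : ℕ) (τ : ℕ → ℝ) :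
    ppSpace d m k τ ≤ ppSpace d m (2 * k + 1) (dyadicOnce k τ) := by
  refine Submodule.span_mono ?_
  rintro _ ⟨j | ⟨i, s⟩, rfl⟩
  · exact ⟨Sum.inl j, rfl⟩
  · refine ⟨Sum.inr (⟨2 * i + 1, by omega⟩, s), ?_⟩
    have : dyadicOnce k τ (2 * i + 1) = τ i := by
      rw [dyadicOnce, if_pos (by omega)]
      congr 1
      omega
    simp [ppFam, this]

lemma linear_mul_mem_ppSpace {d m k : ℕ} {τ : ℕ → ℝ} (hm : m ≤ d) {a f : ℝ → ℝ}
    (ha : IsLinearPoly a) (hf : f ∈ ppSpace d m k τ) :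
    a * f ∈ ppSpace (d + 1) (m + 1) k τ := by
  obtain ⟨c₀, c₁, rfl⟩ := ha
  have hmono : ∀ j ≤ d + 1, monoI j ∈ ppSpace (d + 1) (m + 1) k τ := fun j hj =>
    Submodule.subset_span ⟨Sum.inl ⟨j, by omega⟩, rfl⟩
  have htr : ∀ i < k, ∀ s ≤ m, truncI (τ i) (d + 1 - s) ∈ ppSpace (d + 1) (m + 1) k τ :=
    fun i hi s hs => Submodule.subset_span ⟨Sum.inr (⟨i, hi⟩, ⟨s, by omega⟩), rfl⟩
  induction hf using Submodule.span_induction with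
  | mem f hf =>
    obtain ⟨j | ⟨i, s⟩, rfl⟩ := hf
    · have e : (fun x => c₀ + c₁ * x) * ppFam d m k τ (Sum.inl j) =
          c₀ • monoI j + c₁ • monoI (j + 1) := by
        ext x
        simp only [ppFam, Sum.elim_inl, monoI, Pi.mul_apply, Pi.add_apply, Pi.smul_apply,
          smul_eq_mul]
        split_ifs
        · ring
        · ring
      rw [e]
      exact add_mem (Submodule.smul_mem _ _ (hmono _ (by omega)))
        (Submodule.smul_mem _ _ (hmono _ (by omega)))
    · have e : (fun x => c₀ + c₁ * x) * ppFam d m k τ (Sum.inr (i, s)) =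
          (c₀ + c₁ * τ i) • truncI (τ i) (d + 1 - (s + 1)) +
            (-c₁) • truncI (τ i) (d + 1 - s) := by
        ext x
        have h1 : d + 1 - ((s : ℕ) + 1) = d - s := by omega
        have h2 : d + 1 - (s : ℕ) = d - s + 1 := by omega
        simp only [ppFam, Sum.elim_inr, truncI, Pi.mul_apply, Pi.add_apply, Pi.smul_apply,
          smul_eq_mul, h1, h2]
        split_ifs
        · ring
        · ring
      rw [e]
      exact add_mem (Submodule.smul_mem _ _ (htr _ i.2 _ (by omega)))
        (Submodule.smul_mem _ _ (htr _ i.2 _ (by omega)))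
  | zero => rw [mul_zero]; exact zero_mem _
  | add _ _ _ _ hf hg => rw [mul_add]; exact add_mem hf hg
  | smul _ _ _ hf => rw [mul_smul_comm]; exact Submodule.smul_mem _ _ hf

/-! ### First-order behaviour at the left endpoint -/

/-- `f` has value `a` and one-sided derivative `b` at `0`. -/
def HasJet (f : ℝ → ℝ) (a b : ℝ) : Prop := f 0 = a ∧ HasDerivWithinAt f b (Set.Ici 0) 0

lemma HasJet.add {f g : ℝ → ℝ} {a b a' b' : ℝ} (hf : HasJet f a b) (hg : HasJet g a' b') :
    HasJet (f + g) (a + a') (b + b') :=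
  ⟨by simp [hf.1, hg.1], hf.2.add hg.2⟩

lemma HasJet.smul {f : ℝ → ℝ} {a b : ℝ} (c : ℝ) (hf : HasJet f a b) :
    HasJet (c • f) (c * a) (c * b) :=
  ⟨by simp [hf.1], hf.2.const_smul c⟩

lemma HasJet.affine_mul {f : ℝ → ℝ} {a b : ℝ} (hf : HasJet f a b) (u v : ℝ) :
    HasJet (fun x => (u + v * x) * f x) (u * a) (v * a + u * b) := by
  refine ⟨by simp [hf.1], ?_⟩
  have h1 : HasDerivWithinAt (fun x : ℝ => u + v * x) v (Set.Ici 0) 0 := by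
    simpa using ((hasDerivWithinAt_id (0 : ℝ) (Set.Ici 0)).const_mul v).const_add u
  have h2 := h1.mul hf.2
  simp only [hf.1, mul_zero, add_zero] at h2
  exact h2

lemma HasJet.unique {f : ℝ → ℝ} {a b a' b' : ℝ} (hf : HasJet f a b) (hf' : HasJet f a' b') :
    a = a' ∧ b = b' :=
  ⟨hf.1.symm.trans hf'.1,
    (uniqueDiffWithinAt_Ici (0 : ℝ)).eq_deriv _ hf.2 hf'.2⟩

lemma HasJet.of_eq_const {f : ℝ → ℝ} {a h : ℝ} (hh : 0 < h)
    (hf : ∀ x, 0 ≤ x → x < h → f x = a) : HasJet f a 0 := by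
  have h0 := hf 0 le_rfl hh
  refine ⟨h0, (hasDerivWithinAt_const (0 : ℝ) (Set.Ici 0) a).congr_of_eventuallyEq ?_ h0⟩
  filter_upwards [self_mem_nhdsWithin, mem_nhdsWithin_of_mem_nhds (Iio_mem_nhds hh)] with x h1 h2
  exact hf x h1 h2

lemma IsOpenKnot.hasJet {t : ℕ → ℝ} {D n : ℕ} (ht : IsOpenKnot t D n) (hpos : 0 < t (D + 1)) :
    ∀ d e : ℕ, d + e = D → ∀ i, HasJet (coxDeBoor t d i) (if i = e then 1 else 0)
      (if i = e then -(d / t (D + 1)) else if i = e + 1 then d / t (D + 1) else 0) := by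
  intro d
  have hle := ht.le_one (D + 1)
  induction d with
  | zero =>
    intro e he i
    obtain rfl : e = D := by omega
    have : (if i = e then -(((0 : ℕ) : ℝ) / t (e + 1)) else
      if i = e + 1 then ((0 : ℕ) : ℝ) / t (e + 1) else 0) = 0 := by simp
    rw [this]
    refine HasJet.of_eq_const hpos fun x hx0 hx1 => ?_
    rcases lt_trichotomy i e with hi | rfl | hi
    · rw [if_neg hi.ne]
      apply coxDeBoor_eq_zero_of_eq ht.mono
      rw [ht.zero _ (by omega), ht.zero _ (by omega)]
    · rw [if_pos rfl, coxDeBoor, if_pos]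
      exact Or.inl ⟨by rw [ht.zero _ le_rfl]; exact hx0, hx1⟩
    · rw [if_neg hi.ne']
      exact coxDeBoor_eq_zero_of_lt ht.mono 0 i (hx1.trans_le (ht.mono hi))
  | succ d ih =>
    intro e he i
    have ih := ih (e + 1) (by omega)
    set h := t (D + 1) with hh
    set w : ℕ → ℝ := fun i => if t (i + d + 1) = t i then 0 else (t (i + d + 1) - t i)⁻¹ with hw
    have hrec : coxDeBoor t (d + 1) i =
        (fun x => (-(w i * t i) + w i * x) * coxDeBoor t d i x) +
        (fun x => (w (i + 1) * t (i + d + 2) + (-w (i + 1)) * x) * coxDeBoor t d (i + 1) x) := by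
      ext x
      have e1 : i + 1 + d + 1 = i + d + 2 := by omega
      simp only [coxDeBoor, Pi.add_apply, hw, e1]
      congr 2
      · split_ifs <;> ring
      · split_ifs <;> ring
    rw [hrec]
    have hJ := ((ih i).affine_mul (-(w i * t i)) (w i)).add
      ((ih (i + 1)).affine_mul (w (i + 1) * t (i + d + 2)) (-w (i + 1)))
    have hwe : w (e + 1) = h⁻¹ := by
      have e1 : e + 1 + d + 1 = D + 1 := by omega
      simp only [hw, e1]
      rw [← hh, ht.zero (e + 1) (by omega), if_neg hpos.ne', sub_zero]
    have hte : t (e + 1) = 0 := ht.zero _ (by omega)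
    have htop : t (e + d + 2) = h := by rw [hh]; congr 1; omega
    have hne := hpos.ne'
    rcases lt_trichotomy i e with hi | rfl | hi
    · convert hJ using 1 <;>
        simp [hi.ne, show i ≠ e + 1 by omega, show i ≠ e + 1 + 1 by omega]
    · convert hJ using 1
      · simp [hwe, htop, hne]
      · simp [hwe, htop, show i ≠ i + 1 + 1 by omega]
        field_simp
        ring
    · obtain hi | hi : i = e + 1 ∨ e + 1 < i := by omega
      · subst hi
        have h2 : (d : ℝ) * (w (e + 1 + 1) * t (e + 1 + d + 2)) = d := by
          rcases Nat.eq_zero_or_pos d with rfl | hd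
          · simp
          · have h3 : t (e + 1 + 1) = 0 := ht.zero _ (by omega)
            have e1 : e + 1 + 1 + d + 1 = e + 1 + d + 2 := by omega
            have h4 : 0 < t (e + 1 + d + 2) := hpos.trans_le (ht.mono (by omega))
            simp only [hw, e1, h3]
            rw [if_neg h4.ne', sub_zero, inv_mul_cancel₀ h4.ne', mul_one]
        convert hJ using 1
        · simp [hte]
        · simp only [hte, hwe]
          simp
          field_simp
          linear_combination - h2
      · obtain hi | hi : i = e + 2 ∨ e + 2 < i := by omega
        · subst hi
          have h2 : (d : ℝ) * t (e + 2) = 0 := by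
            rcases Nat.eq_zero_or_pos d with rfl | hd
            · simp
            · rw [ht.zero (e + 2) (by omega), mul_zero]
          convert hJ using 1
          · simp
          · simp
            rcases mul_eq_zero.1 h2 with h3 | h3
            · have h4 : d = 0 := by exact_mod_cast h3
              simp [h4]
            · simp [h3]
        · convert hJ using 1 <;>
            simp [show i ≠ e by omega, show i ≠ e + 1 by omega, show i ≠ e + 2 by omega]

lemma GoodBpt.hasJet {k : ℕ} {τ : ℕ → ℝ} (h : GoodBpt k τ) (d : ℕ) {m : ℕ} (hm : 1 ≤ m) (i : ℕ) :
    HasJet (Bspl d m k τ i) (if i = 0 then 1 else 0)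
      (if i = 0 then -(d / extBpt k τ 1) else if i = 1 then d / extBpt k τ 1 else 0) := by
  have h1 : 0 < extBpt k τ 1 := by
    have := h 0 (Nat.zero_le _)
    rwa [extBpt_zero] at this
  have h2 := (h.isOpenKnot d m).hasJet (by rw [openKnots_first τ hm]; exact h1) d 0 (by simp) i
  rwa [openKnots_first τ hm, zero_add] at h2

/-- The span of the B-splines that vanish to second order at `0`. -/
def tailSpace (d m k : ℕ) (τ : ℕ → ℝ) : Submodule ℝ (ℝ → ℝ) :=
  Submodule.span ℝ (Bspl d m k τ '' {i | 2 ≤ i ∧ i < sdim d m k})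

lemma GoodBpt.hasJet_tailSpace {k : ℕ} {τ : ℕ → ℝ} (h : GoodBpt k τ) {d m : ℕ} (hm : 1 ≤ m)
    {f : ℝ → ℝ} (hf : f ∈ tailSpace d m k τ) : HasJet f 0 0 := by
  induction hf using Submodule.span_induction with
  | mem f hf =>
    obtain ⟨i, ⟨hi, _⟩, rfl⟩ := hf
    simpa [show i ≠ 0 by omega, show i ≠ 1 by omega] using h.hasJet d hm i
  | zero => exact ⟨rfl, hasDerivWithinAt_const _ _ _⟩
  | add _ _ _ _ hf hg => simpa using hf.add hg
  | smul c _ _ hf => simpa using hf.smul c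

lemma exists_sub_mem_tailSpace {d m k : ℕ} {τ : ℕ → ℝ} {f : ℝ → ℝ}
    (hf : f ∈ splineSpace d m k τ) :
    ∃ a b : ℝ, f - (a • Bspl d m k τ 0 + b • Bspl d m k τ 1) ∈ tailSpace d m k τ := by
  induction hf using Submodule.span_induction with
  | mem f hf =>
    obtain ⟨i, hi, rfl⟩ := hf
    rcases Nat.lt_or_ge i 2 with h | h
    · interval_cases i
      · exact ⟨1, 0, by simp⟩
      · exact ⟨0, 1, by simp⟩
    · have hmem : Bspl d m k τ i ∈ tailSpace d m k τ :=
        Submodule.subset_span ⟨i, ⟨h, hi⟩, rfl⟩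
      exact ⟨0, 0, by simpa using hmem⟩
  | zero => exact ⟨0, 0, by simp⟩
  | add _ _ _ _ hf hg =>
    obtain ⟨a, b, h⟩ := hf
    obtain ⟨a', b', h'⟩ := hg
    refine ⟨a + a', b + b', ?_⟩
    convert add_mem h h' using 1
    module
  | smul c _ _ hf =>
    obtain ⟨a, b, h⟩ := hf
    refine ⟨c * a, c * b, ?_⟩
    convert Submodule.smul_mem _ c h using 1
    module

lemma GoodBpt.Bspl_one_sub_mem {k : ℕ} {τ : ℕ → ℝ} (h : GoodBpt k τ) {d m : ℕ} (hm : 1 ≤ m)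
    (hmd : m ≤ d) :
    Bspl d m k τ 1 - (1 / 2 : ℝ) • Bspl d m (2 * k + 1) (dyadicOnce k τ) 1 ∈
      tailSpace d m (2 * k + 1) (dyadicOnce k τ) := by
  have h' := h.refine
  have hd : (d : ℝ) ≠ 0 := by
    have : d ≠ 0 := by omega
    exact_mod_cast this
  have hmem : Bspl d m k τ 1 ∈ splineSpace d m (2 * k + 1) (dyadicOnce k τ) := by
    rw [← h'.ppSpace_eq hmd]
    apply ppSpace_le_dyadicOnce
    rw [h.ppSpace_eq hmd]
    exact Submodule.subset_span ⟨1, by simp only [Set.mem_Iio, sdim]; omega, rfl⟩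
  obtain ⟨a, b, hab⟩ := exists_sub_mem_tailSpace hmem
  have hpos : 0 < extBpt k τ 1 := by
    have := h 0 (Nat.zero_le _)
    rwa [extBpt_zero] at this
  have hhalf : extBpt (2 * k + 1) (dyadicOnce k τ) 1 = extBpt k τ 1 / 2 := by
    have := extBpt_dyadicOnce_odd τ (Nat.zero_le k)
    rwa [extBpt_zero, zero_add, mul_zero, zero_add] at this
  have hJ := (h'.hasJet_tailSpace hm hab).add
    (((h'.hasJet d hm 0).smul a).add ((h'.hasJet d hm 1).smul b))
  rw [sub_add_cancel, hhalf] at hJ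
  obtain ⟨h0, h1⟩ := hJ.unique (h.hasJet d hm 1)
  simp only [if_true, one_ne_zero, if_false, mul_one, mul_zero, add_zero, zero_add] at h0 h1
  subst h0
  have hb : b = 1 / 2 := by
    field_simp at h1
    linarith
  subst hb
  simpa using hab

/-! ### Gluing -/

lemma ASG1.glue_add (G : ASG1) (f f' g g' : ℝ × ℝ → ℝ) :
    G.glue (f + f') (g + g') = G.glue f g + G.glue f' g' := by
  ext x
  simp only [ASG1.glue, Pi.add_apply]
  split_ifs <;> simp

lemma ASG1.glue_smul (G : ASG1) (c : ℝ) (f g : ℝ × ℝ → ℝ) :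
    G.glue (c • f) (c • g) = c • G.glue f g := by
  ext x
  simp only [ASG1.glue, Pi.smul_apply]
  split_ifs <;> simp

/-- Gluing as a linear map. -/
def ASG1.glueHom (G : ASG1) : (ℝ × ℝ → ℝ) × (ℝ × ℝ → ℝ) →ₗ[ℝ] (ℝ × ℝ → ℝ) where
  toFun f := G.glue f.1 f.2
  map_add' _ _ := G.glue_add _ _ _ _
  map_smul' _ _ := G.glue_smul _ _ _

/-- The tensor product `(ξ₁, ξ₂) ↦ a ξ₁ * b ξ₂`, as a bilinear map. -/
def tensorHom : (ℝ → ℝ) →ₗ[ℝ] (ℝ → ℝ) →ₗ[ℝ] (ℝ × ℝ → ℝ) :=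
  LinearMap.mk₂ ℝ (fun a b q => a q.1 * b q.2)
    (fun a a' b => by ext q; simp [add_mul])
    (fun c a b => by ext q; simp [mul_assoc])
    (fun a b b' => by ext q; simp [mul_add])
    (fun c a b => by ext q; simp [mul_left_comm])

/-- A bilinear map sends a pair of spans into any submodule containing the images of generators. -/
lemma bilin_mem_of_mem_span {E F M : Type*} [AddCommGroup E] [Module ℝ E] [AddCommGroup F]
    [Module ℝ F] [AddCommGroup M] [Module ℝ M] (B : E →ₗ[ℝ] F →ₗ[ℝ] M) {s : Set E} {t : Set F}
    {V : Submodule ℝ M} (h : ∀ a ∈ s, ∀ b ∈ t, B a b ∈ V) {a : E} {b : F}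
    (ha : a ∈ Submodule.span ℝ s) (hb : b ∈ Submodule.span ℝ t) : B a b ∈ V := by
  have h1 : ∀ a ∈ s, Submodule.span ℝ t ≤ V.comap (B a) := fun a ha =>
    Submodule.span_le.2 fun b hb => h a ha b hb
  have h2 : Submodule.span ℝ s ≤ V.comap (B.flip b) :=
    Submodule.span_le.2 fun a ha => h1 a ha hb
  exact h2 ha

lemma ASG1.refinement_gamma1_aux (G : ASG1) {k : ℕ} {τ : ℕ → ℝ} (hgood : GoodBpt k τ) {m i : ℕ}
    (hm1 : 1 ≤ m) (hm2 : m ≤ G.p - 1) (hm3 : G.p - G.r = m + 1) (hi : i < sdim (G.p - 1) m k)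
    (c : ℕ → ℝ)
    (hc : ∀ x ∈ I01, Bspl (G.p - 1) m k τ i x =
      ∑ j ∈ Finset.range (sdim (G.p - 1) m (2 * k + 1)),
        c j * Bspl (G.p - 1) m (2 * k + 1) (dyadicOnce k τ) j x)
    {V : Submodule ℝ (ℝ × ℝ → ℝ)}
    (hL : ∀ i' j', 2 ≤ i' → i' < sdim G.p (m + 1) (2 * k + 1) →
      j' < sdim G.p (m + 1) (2 * k + 1) →
      G.phiAt (2 * k + 1) (dyadicOnce k τ) (.inL i' j') ∈ V)
    (hR : ∀ i' j', 2 ≤ i' → i' < sdim G.p (m + 1) (2 * k + 1) →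
      j' < sdim G.p (m + 1) (2 * k + 1) →
      G.phiAt (2 * k + 1) (dyadicOnce k τ) (.inR i' j') ∈ V) :
    G.phiAt k τ (.g1 i) - (1 / 2 : ℝ) • ∑ j ∈ Finset.range (sdim (G.p - 1) m (2 * k + 1)),
      c j • G.phiAt (2 * k + 1) (dyadicOnce k τ) (.g1 j) ∈ V := by
  have hp1 : G.p - 1 + 1 = G.p := by have := G.hp; omega
  have hm4 : G.p - G.r - 1 = m := by omega
  have hgood' : GoodBpt (2 * k + 1) (dyadicOnce k τ) := hgood.refine
  set n := sdim (G.p - 1) m (2 * k + 1) with hn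
  set A : ℝ → ℝ := Bspl G.p (m + 1) k τ 1 -
    (1 / 2 : ℝ) • Bspl G.p (m + 1) (2 * k + 1) (dyadicOnce k τ) 1 with hA
  have hAmem : A ∈ tailSpace G.p (m + 1) (2 * k + 1) (dyadicOnce k τ) :=
    hgood.Bspl_one_sub_mem (by omega) (by omega)
  have hBmem : ∀ a : ℝ → ℝ, IsLinearPoly a → a * Bspl (G.p - 1) m k τ i ∈
      splineSpace G.p (m + 1) (2 * k + 1) (dyadicOnce k τ) := by
    intro a ha
    rw [← hgood'.ppSpace_eq (by omega)]
    have h1 : Bspl (G.p - 1) m k τ i ∈ ppSpace (G.p - 1) m (2 * k + 1) (dyadicOnce k τ) := by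
      apply ppSpace_le_dyadicOnce
      rw [hgood.ppSpace_eq hm2]
      exact Submodule.subset_span ⟨i, hi, rfl⟩
    have h2 := linear_mul_mem_ppSpace hm2 ha h1
    rwa [hp1] at h2
  have hrefine : ∀ x, Bspl (G.p - 1) m k τ i x =
      ∑ j ∈ Finset.range n, c j * Bspl (G.p - 1) m (2 * k + 1) (dyadicOnce k τ) j x := by
    intro x
    by_cases hx : x ∈ I01
    · exact hc x hx
    · have h1 := (hgood.isOpenKnot (G.p - 1) m).coxDeBoor_eq_zero (G.p - 1) i hx
      have h2 := fun j =>
        (hgood'.isOpenKnot (G.p - 1) m).coxDeBoor_eq_zero (G.p - 1) j hx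
      simp [Bspl, h1, h2]
  have hpatch : ∀ a : ℝ → ℝ,
      (fun q => fGamma1 G.p G.r k τ a i q - (1 / 2 : ℝ) *
        ∑ j ∈ Finset.range n, c j * fGamma1 G.p G.r (2 * k + 1) (dyadicOnce k τ) a j q) =
      tensorHom A (a * Bspl (G.p - 1) m k τ i) := by
    intro a
    ext q
    have h1 : ∑ j ∈ Finset.range n,
        c j * fGamma1 G.p G.r (2 * k + 1) (dyadicOnce k τ) a j q =
        a q.2 * Bspl (G.p - 1) m k τ i q.2 *
          Bspl G.p (m + 1) (2 * k + 1) (dyadicOnce k τ) 1 q.1 := by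
      rw [hrefine, Finset.mul_sum, Finset.sum_mul]
      refine Finset.sum_congr rfl fun j _ => ?_
      rw [fGamma1, hm4, hm3]
      ring
    simp only [h1]
    simp only [fGamma1, hm3, Nat.add_sub_cancel, tensorHom, LinearMap.mk₂_apply, hA, Pi.sub_apply, Pi.smul_apply,
      Pi.mul_apply, smul_eq_mul]
    ring
  have hsplit : G.phiAt k τ (.g1 i) -
      (1 / 2 : ℝ) • ∑ j ∈ Finset.range n, c j • G.phiAt (2 * k + 1) (dyadicOnce k τ) (.g1 j) =
      G.glueHom (tensorHom A (G.αL * Bspl (G.p - 1) m k τ i), 0) +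
      G.glueHom (0, tensorHom A (G.αR * Bspl (G.p - 1) m k τ i)) := by
    rw [← hpatch, ← hpatch]
    ext x
    simp only [ASG1.phiAt, ASG1.glueHom, LinearMap.coe_mk, AddHom.coe_mk, ASG1.glue,
      Pi.sub_apply, Pi.smul_apply, Pi.add_apply, Finset.sum_apply, Pi.zero_apply, smul_eq_mul]
    split_ifs <;> simp
  have hΩ : ∀ i' j', fOmega G.p G.r (2 * k + 1) (dyadicOnce k τ) i' j' =
      tensorHom (Bspl G.p (m + 1) (2 * k + 1) (dyadicOnce k τ) i')
        (Bspl G.p (m + 1) (2 * k + 1) (dyadicOnce k τ) j') := by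
    intro i' j'
    ext q
    rw [fOmega, hm3]
    rfl
  rw [hsplit]
  refine add_mem ?_ ?_
  · refine bilin_mem_of_mem_span
      (tensorHom.compr₂ (G.glueHom.comp (LinearMap.inl ℝ (ℝ × ℝ → ℝ) (ℝ × ℝ → ℝ)))) ?_
      hAmem (hBmem G.αL G.hαLlin)
    rintro _ ⟨i', ⟨h1, h2⟩, rfl⟩ _ ⟨j', h3, rfl⟩
    have h4 := hL i' j' h1 h2 h3
    rw [ASG1.phiAt, hΩ] at h4
    exact h4
  · refine bilin_mem_of_mem_span
      (tensorHom.compr₂ (G.glueHom.comp (LinearMap.inr ℝ (ℝ × ℝ → ℝ) (ℝ × ℝ → ℝ)))) ?_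
      hAmem (hBmem G.αR G.hαRlin)
    rintro _ ⟨i', ⟨h1, h2⟩, rfl⟩ _ ⟨j', h3, rfl⟩
    have h4 := hR i' j' h1 h2 h3
    rw [ASG1.phiAt, hΩ] at h4
    exact h4

/-- Refinement of the interface basis functions `φ_{Γ₁,i}`:
if `λ'` is the refinement mask of the B-splines of `S_{p−1}^r` between levels
`ℓ` and `ℓ+1`, then `φ_{Γ₁,i}^ℓ − (1/2) Σ_j λ'_{i,j} φ_{Γ₁,j}^{ℓ+1}` belongs to
the span of the level-`(ℓ+1)` patch-interior basis functions. -/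
theorem refinement_gamma1 (G : ASG1) (ℓ : ℕ) (lam : ℕ → ℕ → ℝ)
    (hlam : ∀ i < sdim (G.p - 1) (G.p - G.r - 1) (levelK G.k ℓ),
      ∀ x ∈ I01,
        Bspl (G.p - 1) (G.p - G.r - 1) (levelK G.k ℓ) (levelτ G.k G.τ ℓ) i x =
          ∑ j ∈ Finset.range (sdim (G.p - 1) (G.p - G.r - 1) (levelK G.k (ℓ + 1))),
            lam i j *
              Bspl (G.p - 1) (G.p - G.r - 1) (levelK G.k (ℓ + 1))
                (levelτ G.k G.τ (ℓ + 1)) j x) :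
    ∀ i < sdim (G.p - 1) (G.p - G.r - 1) (levelK G.k ℓ),
      (G.phiLvl ℓ (.g1 i) -
          (1 / 2 : ℝ) •
            ∑ j ∈ Finset.range (sdim (G.p - 1) (G.p - G.r - 1) (levelK G.k (ℓ + 1))),
              lam i j • G.phiLvl (ℓ + 1) (.g1 j)) ∈
        Submodule.span ℝ
          {f : ℝ × ℝ → ℝ | ∃ i' j' : ℕ,
            2 ≤ i' ∧ i' < sdim G.p (G.p - G.r) (levelK G.k (ℓ + 1)) ∧
              j' < sdim G.p (G.p - G.r) (levelK G.k (ℓ + 1)) ∧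
              (f = G.phiLvl (ℓ + 1) (.inL i' j') ∨ f = G.phiLvl (ℓ + 1) (.inR i' j'))} := by
  intro i hi
  have hp := G.hp
  have hr := G.hr
  have hrp := G.hrp
  have hm : G.p - G.r = G.p - G.r - 1 + 1 := by omega
  refine G.refinement_gamma1_aux (G.goodBpt ℓ) (by omega) (by omega) hm hi (lam i) (hlam i hi)
    (fun i' j' h1 h2 h3 => ?_) (fun i' j' h1 h2 h3 => ?_)
  · rw [← hm] at h2 h3
    exact Submodule.subset_span ⟨i', j', h1, h2, h3, Or.inl rfl⟩
  · rw [← hm] at h2 h3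
    exact Submodule.subset_span ⟨i', j', h1, h2, h3, Or.inr rfl⟩

end TwoPatch
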